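/- The set of invariant polynomials equals the ℂ-subalgebra of R generated by the mesons X₁Y₁, …, X_NY_N together with W := ∏_{i=1}^N X_i and Z := ∏_{i=1}^N Y_i. (The claim of Section 5.2 that for the A_{N−1} quiver gauge theory the gauge-invariant functions are generated by the mesons and the monomials W = ∏X_i and Z = ∏Y_i.) -/

import Mathlib

open MvPolynomial

/-- The exponents `(a, b)` for which `aᵢ - bᵢ` does not depend on `i`, written without
subtraction. -/
def balancedExponents (ι : Type*) : AddSubmonoid (ι ⊕ ι →₀ ℕ) where
  carrier := {d | ∀ i j, d (Sum.inl i) + d (Sum.inr j) = d (Sum.inl j) + d (Sum.inr i)}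
  zero_mem' := by simp
  add_mem' {d e} hd he i j := by
    have := hd i j
    have := he i j
    simp only [Finsupp.add_apply]
    omega

theorem mem_balancedExponents {ι : Type*} {d : ι ⊕ ι →₀ ℕ} :
    d ∈ balancedExponents ι ↔
      ∀ i j, d (Sum.inl i) + d (Sum.inr j) = d (Sum.inl j) + d (Sum.inr i) :=
  Iff.rfl

/-- The polynomials whose exponents all lie in a given additive submonoid form a subalgebra. -/
def supportSubalgebra {σ : Type*} (R : Type*) [CommSemiring R] (S : AddSubmonoid (σ →₀ ℕ)) :
    Subalgebra R (MvPolynomial σ R) where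
  carrier := {f | ∀ d ∈ f.support, d ∈ S}
  mul_mem' {f g} hf hg d hd := by
    classical
    obtain ⟨a, ha, b, hb, rfl⟩ := Finset.mem_add.mp (support_mul f g hd)
    exact S.add_mem (hf a ha) (hg b hb)
  add_mem' {f g} hf hg d hd := by
    classical
    exact (Finset.mem_union.mp (support_add hd)).elim (hf d) (hg d)
  algebraMap_mem' r d hd := by
    rw [algebraMap_eq, C_apply] at hd
    rw [Finset.mem_singleton.mp (support_monomial_subset hd)]
    exact S.zero_mem

theorem mem_supportSubalgebra {σ R : Type*} [CommSemiring R] {S : AddSubmonoid (σ →₀ ℕ)}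
    {f : MvPolynomial σ R} : f ∈ supportSubalgebra R S ↔ ∀ d ∈ f.support, d ∈ S :=
  Iff.rfl

theorem monomial_mem_supportSubalgebra {σ R : Type*} [CommSemiring R]
    {S : AddSubmonoid (σ →₀ ℕ)} {d : σ →₀ ℕ} (hd : d ∈ S) (c : R) :
    monomial d c ∈ supportSubalgebra R S := fun e he => by
  rwa [Finset.mem_singleton.mp (support_monomial_subset he)]

theorem supportSubalgebra_le {σ R : Type*} [CommSemiring R] {S : AddSubmonoid (σ →₀ ℕ)}
    {A : Subalgebra R (MvPolynomial σ R)} (h : ∀ d ∈ S, monomial d 1 ∈ A) :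
    supportSubalgebra R S ≤ A := fun f hf => by
  rw [f.as_sum]
  refine A.sum_mem fun d hd => ?_
  rw [← mul_one (coeff d f), ← smul_eq_mul, ← smul_monomial]
  exact A.smul_mem (h d (hf d hd)) _

/-- The mesons `XᵢYᵢ` together with `∏ᵢ Xᵢ` and `∏ᵢ Yᵢ`. -/
def quiverGenerators (ι R : Type*) [Fintype ι] [CommSemiring R] :
    Set (MvPolynomial (ι ⊕ ι) R) :=
  (Set.range fun i : ι => X (Sum.inl i) * X (Sum.inr i)) ∪
    {∏ i : ι, X (Sum.inl i), ∏ i : ι, X (Sum.inr i)}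

theorem monomial_one_eq_prod_sum {ι R : Type*} [Fintype ι] [CommSemiring R]
    (d : ι ⊕ ι →₀ ℕ) :
    (monomial d 1 : MvPolynomial (ι ⊕ ι) R) =
      (∏ i, X (Sum.inl i) ^ d (Sum.inl i)) * ∏ i, X (Sum.inr i) ^ d (Sum.inr i) := by
  rw [monomial_eq, C_1, one_mul, Finsupp.prod_fintype _ _ fun _ => pow_zero _,
    Fintype.prod_sum_type]

theorem monomial_mem_adjoin_quiverGenerators {ι R : Type*} [Fintype ι] [CommSemiring R]
    {d : ι ⊕ ι →₀ ℕ} (hd : d ∈ balancedExponents ι) :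
    monomial d 1 ∈ Algebra.adjoin R (quiverGenerators ι R) := by
  have meson (i : ι) : X (Sum.inl i) * X (Sum.inr i) ∈
      Algebra.adjoin R (quiverGenerators ι R) :=
    Algebra.subset_adjoin (Or.inl ⟨i, rfl⟩)
  have hW : ∏ i : ι, X (Sum.inl i) ∈ Algebra.adjoin R (quiverGenerators ι R) :=
    Algebra.subset_adjoin (Or.inr (Or.inl rfl))
  have hZ : ∏ i : ι, X (Sum.inr i) ∈ Algebra.adjoin R (quiverGenerators ι R) :=
    Algebra.subset_adjoin (Or.inr (Or.inr rfl))
  rw [monomial_one_eq_prod_sum]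
  cases isEmpty_or_nonempty ι with
  | inl _ => simp
  | inr h =>
    obtain ⟨j⟩ := h
    rw [mem_balancedExponents] at hd
    rcases le_total (d (Sum.inr j)) (d (Sum.inl j)) with hj | hj
    · obtain ⟨k, hk⟩ := Nat.exists_eq_add_of_le hj
      have hdk (i : ι) : d (Sum.inl i) = d (Sum.inr i) + k := by
        have := hd i j
        omega
      simp_rw [hdk, pow_add, Finset.prod_mul_distrib, Finset.prod_pow _ k]
      rw [mul_right_comm, ← Finset.prod_mul_distrib]
      simp_rw [← mul_pow]
      exact mul_mem (prod_mem fun i _ => pow_mem (meson i) _) (pow_mem hW k)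
    · obtain ⟨k, hk⟩ := Nat.exists_eq_add_of_le hj
      have hdk (i : ι) : d (Sum.inr i) = d (Sum.inl i) + k := by
        have := hd i j
        omega
      simp_rw [hdk, pow_add, Finset.prod_mul_distrib, Finset.prod_pow _ k]
      rw [← mul_assoc, ← Finset.prod_mul_distrib]
      simp_rw [← mul_pow]
      exact mul_mem (prod_mem fun i _ => pow_mem (meson i) _) (pow_mem hZ k)

theorem quiverGenerators_subset_supportSubalgebra (ι R : Type*) [Fintype ι] [CommSemiring R] :
    quiverGenerators ι R ⊆ supportSubalgebra R (balancedExponents ι) := by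
  classical
  rintro _ (⟨i, rfl⟩ | rfl | rfl)
  · simp only [X, monomial_mul, one_mul]
    refine monomial_mem_supportSubalgebra (mem_balancedExponents.mpr fun j k => ?_) _
    simp [Finsupp.single_apply, add_comm]
  all_goals
    simp only [X, ← monomial_sum_one]
    refine monomial_mem_supportSubalgebra (mem_balancedExponents.mpr fun j k => ?_) _
    simp [Finsupp.finsetSum_apply, Finsupp.single_apply]

theorem adjoin_quiverGenerators (ι R : Type*) [Fintype ι] [CommSemiring R] :
    Algebra.adjoin R (quiverGenerators ι R) = supportSubalgebra R (balancedExponents ι) :=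
  le_antisymm (Algebra.adjoin_le (quiverGenerators_subset_supportSubalgebra ι R))
    (supportSubalgebra_le fun _ => monomial_mem_adjoin_quiverGenerators)

theorem forall_sum_charge_mul_eq_zero_iff {N : ℕ} (hN : 1 ≤ N) (v : Fin N → ℤ) :
    (∀ a : Fin (N - 1),
        ∑ i : Fin N,
          ((if (i : ℕ) = 0 then (-1 : ℤ) else 0) +
            (if (i : ℕ) = (a : ℕ) + 1 then 1 else 0)) * v i = 0) ↔
      ∀ i j, v i = v j := by
  obtain ⟨n, rfl⟩ := Nat.exists_eq_add_of_le' hN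
  have key (a : Fin n) :
      ∑ i : Fin (n + 1), ((if (i : ℕ) = 0 then (-1 : ℤ) else 0) +
        (if (i : ℕ) = (a : ℕ) + 1 then 1 else 0)) * v i = v a.succ - v 0 := by
    have h0 (i : Fin (n + 1)) : (i : ℕ) = 0 ↔ i = 0 := Fin.val_eq_zero_iff
    have hs (i : Fin (n + 1)) : (i : ℕ) = (a : ℕ) + 1 ↔ i = a.succ := by
      rw [Fin.ext_iff, Fin.val_succ]
    simp only [h0, hs, add_mul, ite_mul, zero_mul, one_mul, Finset.sum_add_distrib,
      Finset.sum_ite_eq', Finset.mem_univ, if_true]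
    ring
  change (∀ a : Fin n, _) ↔ _
  simp_rw [key, sub_eq_zero]
  refine ⟨fun h => ?_, fun h a => h _ _⟩
  have h0 (i : Fin (n + 1)) : v i = v 0 := Fin.cases rfl h i
  exact fun i j => (h0 i).trans (h0 j).symm

/-- Gauge invariants of the `A_{N-1}` quiver gauge theory: a polynomial
`f ∈ ℂ[X₁,…,X_N,Y₁,…,Y_N]` is invariant (every monomial in its support has weight zero
for each of the `N-1` U(1) charges, where the `a`-th charge of `Xᵢ` is
`Q a i = (−1 if i = 1) + (1 if i = a+1)` and `Yᵢ` has the opposite charge) if and only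
if it lies in the ℂ-subalgebra generated by the mesons `XᵢYᵢ` together with
`W = ∏ᵢ Xᵢ` and `Z = ∏ᵢ Yᵢ`. -/
theorem aN_quiver_invariants (N : ℕ) (hN : 1 ≤ N)
    (f : MvPolynomial (Fin N ⊕ Fin N) ℂ) :
    (∀ d ∈ f.support, ∀ a : Fin (N - 1),
        ∑ i : Fin N,
          ((if (i : ℕ) = 0 then (-1 : ℤ) else 0) + (if (i : ℕ) = (a : ℕ) + 1 then 1 else 0)) *
            ((d (Sum.inl i) : ℤ) - (d (Sum.inr i) : ℤ)) = 0) ↔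
      f ∈ Algebra.adjoin ℂ
        ((Set.range fun i : Fin N => X (Sum.inl i) * X (Sum.inr i)) ∪
          {∏ i : Fin N, X (Sum.inl i), ∏ i : Fin N, X (Sum.inr i)}) := by
  change _ ↔ f ∈ Algebra.adjoin ℂ (quiverGenerators (Fin N) ℂ)
  rw [adjoin_quiverGenerators, mem_supportSubalgebra]
  refine forall₂_congr fun d _ => ?_
  rw [forall_sum_charge_mul_eq_zero_iff hN fun i => (d (Sum.inl i) : ℤ) - d (Sum.inr i),
    mem_balancedExponents]
  refine forall₂_congr fun i j => ?_
  omega
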